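/- (Lemma 5: upper bound on the service rate of spread allocations under probabilistic access) Let m and α be positive integers with α ≥ 2, let μ > 0 be a real number, and let p ∈ [0,1) be a real number. Then ∑_{k=α}^{mα} C(mα,k) · (1−p)^k · p^{mα−k} · μ_s(α|k) < m·μ·(1−p), where μ_s(α|k) = μ / (H_k − H_{k−α}) and H_k = ∑_{j=1}^k 1/j. -/

import Mathlib

/-- The `k`-th harmonic number `H k = ∑_{j=1}^k 1/j` as a real number. -/
noncomputable def harmonicNumber (n : ℕ) : ℝ := ∑ j ∈ Finset.Icc 1 n, (1 : ℝ) / j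

/-- The conditional service rate `μ_s(α|k) = μ / (H_k − H_{k−α})`. -/
noncomputable def condServiceRate (μ : ℝ) (α k : ℕ) : ℝ :=
  μ / (harmonicNumber k - harmonicNumber (k - α))

theorem harmonicNumber_add_sub (a n : ℕ) :
    harmonicNumber (a + n) - harmonicNumber a = ∑ i ∈ Finset.range n, (1 : ℝ) / (a + i + 1) := by
  induction n with
  | zero => simp
  | succ n ih =>
    have h : harmonicNumber (a + (n + 1)) = harmonicNumber (a + n) + 1 / (a + n + 1) := by
      unfold harmonicNumber
      rw [← add_assoc, Finset.sum_Icc_succ_top (by omega)]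
      push_cast
      ring
    rw [Finset.sum_range_succ, ← ih, h]
    ring

theorem div_lt_harmonicNumber_sub {α k : ℕ} (hα : 2 ≤ α) (hk : α ≤ k) :
    (α : ℝ) / k < harmonicNumber k - harmonicNumber (k - α) := by
  obtain ⟨a, rfl⟩ := Nat.exists_eq_add_of_le' hk
  rw [Nat.add_sub_cancel, harmonicNumber_add_sub]
  have hconst : (α : ℝ) / ((a + α : ℕ) : ℝ)
      = ∑ _i ∈ Finset.range α, (1 : ℝ) / ((a + α : ℕ) : ℝ) := by
    simp [div_eq_mul_inv]
  rw [hconst]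
  refine Finset.sum_lt_sum (fun i hi => ?_) ⟨0, by simp; omega, ?_⟩
  · have : i + 1 ≤ α := Finset.mem_range.mp hi
    refine one_div_le_one_div_of_le (by positivity) ?_
    exact_mod_cast (by omega : a + i + 1 ≤ a + α)
  · refine one_div_lt_one_div_of_lt (by positivity) ?_
    exact_mod_cast (by omega : a + 0 + 1 < a + α)

theorem condServiceRate_lt {α k : ℕ} (hα : 2 ≤ α) (hk : α ≤ k) {μ : ℝ} (hμ : 0 < μ) :
    condServiceRate μ α k < k * (μ / α) := by
  have hα' : (0 : ℝ) < α := by exact_mod_cast (by omega : 0 < α)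
  have hk' : (0 : ℝ) < k := by exact_mod_cast (by omega : 0 < k)
  calc condServiceRate μ α k < μ / (α / k) :=
        div_lt_div_of_pos_left hμ (by positivity) (div_lt_harmonicNumber_sub hα hk)
    _ = k * (μ / α) := by field_simp

theorem sum_binomial_mul_natCast (n : ℕ) (q : ℝ) :
    ∑ k ∈ Finset.range (n + 1), (n.choose k : ℝ) * q ^ k * (1 - q) ^ (n - k) * k = n * q := by
  have h := congrArg (Polynomial.eval q) (bernsteinPolynomial.sum_smul ℝ n)
  simp only [bernsteinPolynomial, Polynomial.eval_finsetSum, nsmul_eq_mul, Polynomial.eval_mul,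
    Polynomial.eval_natCast, Polynomial.eval_pow, Polynomial.eval_X, Polynomial.eval_sub,
    Polynomial.eval_one] at h
  rw [← h]
  exact Finset.sum_congr rfl fun k _ => by ring

/-- Lemma 5: in the probabilistic access model, for `α ≥ 2`, the average
service rate of the `(α, mα)` quasi-symmetric allocation is strictly less
than `m·μ·(1−p)`. -/
theorem spread_allocation_service_rate_lt_prob (m α : ℕ) (hm : 0 < m)
    (hα : 2 ≤ α) (μ p : ℝ) (hμ : 0 < μ) (hp0 : 0 ≤ p) (hp1 : p < 1) :
    ∑ k ∈ Finset.Icc α (m * α),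
        ((Nat.choose (m * α) k : ℕ) : ℝ) * (1 - p) ^ k * p ^ (m * α - k)
          * condServiceRate μ α k
      < m * μ * (1 - p) := by
  have hα' : (0 : ℝ) < α := by exact_mod_cast (by omega : 0 < α)
  have hq : 0 < 1 - p := by linarith
  have hle : α ≤ m * α := Nat.le_mul_of_pos_left α hm
  calc ∑ k ∈ Finset.Icc α (m * α),
        ((Nat.choose (m * α) k : ℕ) : ℝ) * (1 - p) ^ k * p ^ (m * α - k) * condServiceRate μ α k
      < ∑ k ∈ Finset.Icc α (m * α),
          ((Nat.choose (m * α) k : ℕ) : ℝ) * (1 - p) ^ k * p ^ (m * α - k) * (k * (μ / α)) := by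
        refine Finset.sum_lt_sum (fun k hk => ?_) ⟨m * α, by simpa using hle, ?_⟩
        · exact mul_le_mul_of_nonneg_left
            (condServiceRate_lt hα (Finset.mem_Icc.mp hk).1 hμ).le (by positivity)
        · refine mul_lt_mul_of_pos_left (condServiceRate_lt hα hle hμ) ?_
          simp [hq]
    _ ≤ ∑ k ∈ Finset.range (m * α + 1),
          ((Nat.choose (m * α) k : ℕ) : ℝ) * (1 - p) ^ k * p ^ (m * α - k) * (k * (μ / α)) := by
        refine Finset.sum_le_sum_of_subset_of_nonneg (fun k hk => ?_) fun k _ _ => by positivity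
        have := (Finset.mem_Icc.mp hk).2
        exact Finset.mem_range.mpr (by omega)
    _ = ((m * α : ℕ) * (1 - p)) * (μ / α) := by
        rw [← sum_binomial_mul_natCast, Finset.sum_mul]
        exact Finset.sum_congr rfl fun k _ => by rw [sub_sub_cancel, mul_assoc _ (k : ℝ)]
    _ = m * μ * (1 - p) := by
        push_cast
        field_simp
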